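/- Let V be a finite dimensional vector space over ℚ with an alternating bilinear form B : V → V → ℚ. Let G be a group acting on V by linear automorphisms, generated by a set S of elements each acting as a symplectic transvection x ↦ x - B(x,δ_s)·δ_s for some δ_s ∈ V. Suppose V = V₁ ⊕ V₂ is an internal direct sum of two G-invariant subspaces on each of which G acts irreducibly (i.e. V₁ and V₂ have no proper nonzero G-invariant subspaces). Let Γ ≤ G be a subgroup of finite index and let H ⊆ V be a linear subspace with γ·H ⊆ H for all γ ∈ Γ. Then H is one of: {0}, V₁, V₂, all of V, or the graph {x + f x : x ∈ V₁} of a G-equivariant linear isomorphism f : V₁ → V₂. -/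

import Mathlib

section Transvection

variable {K V G : Type*} [Field K] [AddCommGroup V] [Module K V]

/-- Iterates of an element acting as a symplectic transvection. -/
lemma transvection_pow_smul [Monoid G] [DistribMulAction G V] {B : LinearMap.BilinForm K V}
    (hB : B.IsAlt) {s : G} {δ : V} (hs : ∀ x : V, s • x = x - B x δ • δ) (n : ℕ) (x : V) :
    s ^ n • x = x - ((n : K) * B x δ) • δ := by
  induction n with
  | zero => simp
  | succ n ih =>
    rw [pow_succ', mul_smul, ih, hs]
    simp only [map_sub, map_smul, LinearMap.sub_apply, LinearMap.smul_apply, hB δ, smul_zero,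
      sub_zero, Nat.cast_add, Nat.cast_one, add_mul, one_mul, add_smul]
    abel

variable [Group G] [DistribMulAction G V]

/-- In characteristic zero, a subspace stable under a finite-index subgroup of a group generated
by symplectic transvections is stable under the whole group. -/
lemma smul_mem_of_closure_transvections [CharZero K] {B : LinearMap.BilinForm K V} (hB : B.IsAlt)
    {S : Set G} (hS : Subgroup.closure S = ⊤)
    (hSt : ∀ s ∈ S, ∃ δ : V, ∀ x : V, s • x = x - B x δ • δ)
    {Γ : Subgroup G} (hΓ : Γ.FiniteIndex) {H : Submodule K V}
    (hH : ∀ γ ∈ Γ, ∀ x ∈ H, γ • x ∈ H) (g : G) : ∀ x ∈ H, g • x ∈ H := by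
  have hg : g ∈ Subgroup.closure S := hS ▸ Subgroup.mem_top g
  induction hg using Subgroup.closure_induction with
  | mem s hs =>
    intro x hx
    obtain ⟨δ, hδ⟩ := hSt s hs
    obtain ⟨n, hn, -, hmem⟩ := Subgroup.exists_pow_mem_of_index_ne_zero hΓ.index_ne_zero s
    have h := H.sub_mem hx (hH _ hmem x hx)
    rw [transvection_pow_smul hB hδ, sub_sub_cancel, mul_smul,
      H.smul_mem_iff (Nat.cast_ne_zero.mpr hn.ne')] at h
    exact hδ x ▸ H.sub_mem hx h
  | one => simp
  | mul a b _ _ iha ihb =>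
    intro x hx
    rw [mul_smul]
    exact iha _ (ihb x hx)
  | inv a _ ih =>
    intro x hx
    obtain ⟨n, hn, -, hmem⟩ := Subgroup.exists_pow_mem_of_index_ne_zero hΓ.index_ne_zero a
    have hpow : ∀ m : ℕ, ∀ y ∈ H, a ^ m • y ∈ H := by
      intro m
      induction m with
      | zero => simp
      | succ m ihm =>
        intro y hy
        rw [pow_succ', mul_smul]
        exact ih _ (ihm y hy)
    have h := hpow (n - 1) _ (hH _ (Γ.inv_mem hmem) x hx)
    obtain ⟨m, rfl⟩ := Nat.exists_eq_succ_of_ne_zero hn.ne'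
    rw [← mul_smul] at h
    convert h using 2
    simp [pow_succ']

end Transvection

section Projection

variable {K V G : Type*} [Field K] [AddCommGroup V] [Module K V] [Group G] [DistribMulAction G V]
  {V₁ V₂ : Submodule K V}

/-- The projection along an invariant decomposition is equivariant. -/
lemma coe_projectionOnto_smul (h : IsCompl V₁ V₂)
    (hV₁ : ∀ g : G, ∀ x ∈ V₁, g • x ∈ V₁) (hV₂ : ∀ g : G, ∀ x ∈ V₂, g • x ∈ V₂) (g : G) (x : V) :
    (V₁.projectionOnto V₂ h (g • x) : V) = g • (V₁.projectionOnto V₂ h x : V) := by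
  obtain ⟨a, ha, b, hb, rfl⟩ := Submodule.mem_sup.mp (h.sup_eq_top ▸ Submodule.mem_top (x := x))
  rw [smul_add, map_add, map_add, Submodule.projectionOnto_apply_of_mem_left h (hV₁ g a ha),
    Submodule.projectionOnto_apply_of_mem_right h (hV₂ g b hb),
    Submodule.projectionOnto_apply_of_mem_left h ha,
    Submodule.projectionOnto_apply_of_mem_right h hb]
  simp

/-- An invariant subspace meeting both summands trivially projects isomorphically onto an
irreducible summand, unless it is zero. -/
lemma bijective_projectionOnto_domRestrict [SMulCommClass G K V] (h : IsCompl V₁ V₂)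
    (hV₁ : ∀ g : G, ∀ x ∈ V₁, g • x ∈ V₁) (hV₂ : ∀ g : G, ∀ x ∈ V₂, g • x ∈ V₂)
    (hirr : ∀ W : Submodule K V, W ≤ V₁ → (∀ g : G, ∀ x ∈ W, g • x ∈ W) → W = ⊥ ∨ W = V₁)
    {H : Submodule K V} (hH : ∀ g : G, ∀ x ∈ H, g • x ∈ H) (hHV₂ : H ⊓ V₂ = ⊥) (hne : H ≠ ⊥) :
    Function.Bijective ((V₁.projectionOnto V₂ h).domRestrict H) := by
  have hinj : ∀ x ∈ H, V₁.projectionOnto V₂ h x = 0 → x = 0 := fun x hx h0 =>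
    (Submodule.mem_bot K).mp
      (hHV₂ ▸ ⟨hx, (Submodule.projectionOnto_apply_eq_zero_iff h).mp h0⟩)
  refine ⟨(injective_iff_map_eq_zero _).mpr fun x hx => Subtype.ext (hinj x x.2 hx), ?_⟩
  rcases hirr (H.map (V₁.subtype ∘ₗ V₁.projectionOnto V₂ h)) (by
      rintro _ ⟨x, -, rfl⟩
      exact (V₁.projectionOnto V₂ h x).2) (by
      rintro g _ ⟨x, hx, rfl⟩
      exact ⟨g • x, hH g x hx, coe_projectionOnto_smul h hV₁ hV₂ g x⟩) with h0 | htop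
  · refine absurd ((Submodule.eq_bot_iff H).mpr fun x hx => hinj x hx ?_) hne
    have hx' := Submodule.mem_map_of_mem (f := V₁.subtype ∘ₗ V₁.projectionOnto V₂ h) hx
    rw [h0, Submodule.mem_bot] at hx'
    exact Subtype.ext hx'
  · intro y
    obtain ⟨x, hx, hxy⟩ := htop.ge y.2
    exact ⟨⟨x, hx⟩, Subtype.ext hxy⟩

end Projection


/-- Representation-theoretic core of Theorem 3.1: for a group `G` generated by
symplectic transvections acting on `V = V₁ ⊕ V₂` with both summands
`G`-invariant and `G`-irreducible, any subspace `H` invariant under a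
finite-index subgroup `Γ` is `0`, `V₁`, `V₂`, `V`, or the graph
`{x + f x : x ∈ V₁}` of a `G`-equivariant linear isomorphism `f : V₁ ≃ V₂`. -/
theorem transvection_group_subspace_classification
    (V : Type*) [AddCommGroup V] [Module ℚ V] [FiniteDimensional ℚ V]
    (B : LinearMap.BilinForm ℚ V) (hB : B.IsAlt)
    (G : Type*) [Group G] [DistribMulAction G V] [SMulCommClass G ℚ V]
    (S : Set G) (hS : Subgroup.closure S = ⊤)
    (hSt : ∀ s ∈ S, ∃ δ : V, ∀ x : V, s • x = x - B x δ • δ)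
    (V₁ V₂ : Submodule ℚ V) (hcompl : IsCompl V₁ V₂)
    (hV₁ : ∀ g : G, ∀ x ∈ V₁, g • x ∈ V₁)
    (hV₂ : ∀ g : G, ∀ x ∈ V₂, g • x ∈ V₂)
    (hirr₁ : ∀ W : Submodule ℚ V, W ≤ V₁ → (∀ g : G, ∀ x ∈ W, g • x ∈ W) →
      W = ⊥ ∨ W = V₁)
    (hirr₂ : ∀ W : Submodule ℚ V, W ≤ V₂ → (∀ g : G, ∀ x ∈ W, g • x ∈ W) →
      W = ⊥ ∨ W = V₂)
    (Γ : Subgroup G) (hΓ : Γ.FiniteIndex)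
    (H : Submodule ℚ V) (hH : ∀ γ ∈ Γ, ∀ x ∈ H, γ • x ∈ H) :
    H = ⊥ ∨ H = V₁ ∨ H = V₂ ∨ H = ⊤ ∨
      ∃ f : V₁ ≃ₗ[ℚ] V₂,
        (∀ (g : G) (x : V₁),
          g • (f x : V) = (f ⟨g • (x : V), hV₁ g x x.2⟩ : V)) ∧
        ∀ v : V, v ∈ H ↔ ∃ x : V₁, v = (x : V) + (f x : V) := by
  have hG := smul_mem_of_closure_transvections hB hS hSt hΓ hH
  have hinf : ∀ W : Submodule ℚ V, (∀ g : G, ∀ x ∈ W, g • x ∈ W) →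
      ∀ g : G, ∀ x ∈ H ⊓ W, g • x ∈ H ⊓ W :=
    fun W hW g x hx => ⟨hG g x hx.1, hW g x hx.2⟩
  rcases hirr₁ (H ⊓ V₁) inf_le_right (hinf V₁ hV₁) with h₁ | h₁ <;>
    rcases hirr₂ (H ⊓ V₂) inf_le_right (hinf V₂ hV₂) with h₂ | h₂
  · by_cases hne : H = ⊥
    · exact Or.inl hne
    refine Or.inr <| Or.inr <| Or.inr <| Or.inr ?_
    let e₁ : H ≃ₗ[ℚ] V₁ := LinearEquiv.ofBijective _
      (bijective_projectionOnto_domRestrict hcompl hV₁ hV₂ hirr₁ hG h₂ hne)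
    let e₂ : H ≃ₗ[ℚ] V₂ := LinearEquiv.ofBijective _
      (bijective_projectionOnto_domRestrict hcompl.symm hV₂ hV₁ hirr₂ hG h₁ hne)
    have he : ∀ x : H, (e₁ x : V) + (e₂ x : V) = x := fun x =>
      Submodule.projection_add_projection_eq_self hcompl (x : V)
    refine ⟨e₁.symm ≪≫ₗ e₂, fun g x => ?_, fun v => ⟨fun hv => ?_, ?_⟩⟩
    · obtain ⟨y, rfl⟩ := e₁.surjective x
      have hy : (⟨g • (e₁ y : V), hV₁ g _ (e₁ y).2⟩ : V₁) = e₁ ⟨g • (y : V), hG g y y.2⟩ :=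
        Subtype.ext (coe_projectionOnto_smul hcompl hV₁ hV₂ g (y : V)).symm
      rw [hy, LinearEquiv.trans_apply, LinearEquiv.trans_apply, e₁.symm_apply_apply,
        e₁.symm_apply_apply]
      exact (coe_projectionOnto_smul hcompl.symm hV₂ hV₁ g (y : V)).symm
    · refine ⟨e₁ ⟨v, hv⟩, ?_⟩
      rw [LinearEquiv.trans_apply, e₁.symm_apply_apply, he]
    · rintro ⟨x, rfl⟩
      obtain ⟨y, rfl⟩ := e₁.surjective x
      rw [LinearEquiv.trans_apply, e₁.symm_apply_apply, he]
      exact y.2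
  · have hle : V₂ ≤ H := inf_eq_right.mp h₂
    refine Or.inr <| Or.inr <| Or.inl ?_
    calc H = (V₂ ⊔ V₁) ⊓ H := by rw [sup_comm, hcompl.sup_eq_top, top_inf_eq]
      _ = V₂ := by rw [sup_inf_assoc_of_le V₁ hle, inf_comm, h₁, sup_bot_eq]
  · have hle : V₁ ≤ H := inf_eq_right.mp h₁
    refine Or.inr <| Or.inl ?_
    calc H = (V₁ ⊔ V₂) ⊓ H := by rw [hcompl.sup_eq_top, top_inf_eq]
      _ = V₁ := by rw [sup_inf_assoc_of_le V₂ hle, inf_comm, h₂, sup_bot_eq]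
  · refine Or.inr <| Or.inr <| Or.inr <| Or.inl <| top_le_iff.mp ?_
    rw [← hcompl.sup_eq_top]
    exact sup_le (inf_eq_right.mp h₁) (inf_eq_right.mp h₂)
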